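/- Let f be a tiling of ℤ² by the Wang set 𝒯_D = 𝒯_a ∪ 𝒯_b. Then every row of f uses tiles of only one of 𝒯_a, 𝒯_b; define v : ℤ → {a,b} by v(y) = a if row y uses tiles of 𝒯_a and v(y) = b otherwise. Then there exists a strictly increasing sequence (p_k)_{k∈ℤ} of integers with p_k → ±∞ such that for every k, the word v(p_k) v(p_k+1) ⋯ v(p_{k+1}−1) is one of the blocks b, aa, bab; that is, v is a biinfinite concatenation of the blocks b, aa and bab. -/

import Mathlib

structure WangTile (H V : Type*) where
  west : H
  east : H
  south : V
  north : V
deriving DecidableEq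

def TilingOn {H V : Type*} (T : Set (WangTile H V)) (X : Set (ℤ × ℤ))
    (f : ℤ × ℤ → WangTile H V) : Prop :=
  (∀ p ∈ X, f p ∈ T) ∧
  (∀ x y : ℤ, (x, y) ∈ X → (x + 1, y) ∈ X →
    (f (x, y)).east = (f (x + 1, y)).west) ∧
  (∀ x y : ℤ, (x, y) ∈ X → (x, y + 1) ∈ X →
    (f (x, y)).north = (f (x, y + 1)).south)

def Tiling {H V : Type*} (T : Set (WangTile H V)) (f : ℤ × ℤ → WangTile H V) : Prop :=
  TilingOn T Set.univ f

def TilesPlane {H V : Type*} (T : Set (WangTile H V)) : Prop :=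
  ∃ f, Tiling T f

def PeriodicTiling {H V : Type*} (f : ℤ × ℤ → WangTile H V) : Prop :=
  ∃ u v : ℤ, (u, v) ≠ (0, 0) ∧ ∀ x y : ℤ, f (x + u, y + v) = f (x, y)

def Aperiodic {H V : Type*} (T : Set (WangTile H V)) : Prop :=
  TilesPlane T ∧ ∀ f, Tiling T f → ¬ PeriodicTiling f

def MinimallyAperiodic {H V : Type*} (T : Set (WangTile H V)) : Prop :=
  Aperiodic T ∧ ∀ S : Set (WangTile H V), S ⊂ T → ¬ TilesPlane S

/-- The twenty horizontal colors of the Wang set `𝒯_D = 𝒯_a ∪ 𝒯_b`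
(`a,…,j` for `𝒯_a` and `K,…,R` for `𝒯_b`). -/
inductive HC
  | a | b | c | d | e | f | g | h | i | j
  | K | L | M | M' | N | O | O' | P | Q | R
deriving DecidableEq

open HC in
/-- The Wang set `𝒯_a`: horizontal colors `a,…,j`, vertical colors `0, 1`.
Tiles are written `⟨west, east, south, north⟩`. -/
def Ta : Set (WangTile HC (Fin 2)) :=
  { ⟨a, b, 1, 0⟩, ⟨f, b, 1, 1⟩, ⟨g, a, 1, 1⟩, ⟨e, f, 1, 1⟩, ⟨c, d, 1, 0⟩,
    ⟨b, c, 1, 0⟩, ⟨b, g, 1, 1⟩, ⟨d, e, 1, 1⟩, ⟨i, j, 0, 0⟩, ⟨c, i, 0, 0⟩,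
    ⟨d, h, 0, 0⟩, ⟨j, a, 0, 0⟩, ⟨h, c, 0, 0⟩, ⟨h, g, 0, 1⟩ }

open HC in
/-- The Wang set `𝒯_b`: horizontal colors `K,…,R`, vertical colors `0, 1`. -/
def Tb : Set (WangTile HC (Fin 2)) :=
  { ⟨P, R, 1, 1⟩, ⟨M', K, 1, 1⟩, ⟨R, M, 1, 1⟩, ⟨R, M', 1, 1⟩, ⟨Q, O', 0, 0⟩,
    ⟨N, O, 0, 1⟩, ⟨P, Q, 0, 1⟩, ⟨M, N, 0, 1⟩, ⟨R, L, 0, 0⟩, ⟨K, L, 0, 1⟩,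
    ⟨O, R, 0, 0⟩, ⟨O, P, 0, 1⟩, ⟨L, M, 0, 1⟩, ⟨O', R, 0, 0⟩ }

/-- The Wang set `𝒯_D = 𝒯_a ∪ 𝒯_b`. -/
def TD : Set (WangTile HC (Fin 2)) := Ta ∪ Tb

namespace TDRows

/-- Coded tiles: west, east, south, north. -/
abbrev Tl := ℕ × ℕ × ℕ × ℕ

def LA : List Tl :=
  [(0,1,1,0), (5,1,1,1), (6,0,1,1), (4,5,1,1), (2,3,1,0), (1,2,1,0), (1,6,1,1), (3,4,1,1),
   (8,9,0,0), (2,8,0,0), (3,7,0,0), (9,0,0,0), (7,2,0,0), (7,6,0,1)]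

/-- The ten colors of the second set are coded in the listed order. -/
def LB : List Tl :=
  [(7,9,1,1), (3,0,1,1), (9,2,1,1), (9,3,1,1), (8,6,0,0), (4,5,0,1), (7,8,0,1), (2,4,0,1),
   (9,1,0,0), (0,1,0,1), (5,9,0,0), (5,7,0,1), (1,2,0,1), (6,9,0,0)]

def code : HC → ℕ
  | .a => 0 | .b => 1 | .c => 2 | .d => 3 | .e => 4 | .f => 5 | .g => 6 | .h => 7 | .i => 8 | .j => 9
  | .K => 0 | .L => 1 | .M => 2 | .M' => 3 | .N => 4 | .O => 5 | .O' => 6 | .P => 7 | .Q => 8 | .R => 9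

def isA : HC → Bool
  | .a | .b | .c | .d | .e | .f | .g | .h | .i | .j => true
  | _ => false

def enc (t : WangTile HC (Fin 2)) : Tl := (code t.west, code t.east, t.south.val, t.north.val)

theorem Ta_spec {t : WangTile HC (Fin 2)} (h : t ∈ Ta) :
    isA t.west = true ∧ isA t.east = true ∧ enc t ∈ LA := by
  simp only [Ta, Set.mem_insert_iff, Set.mem_singleton_iff] at h
  rcases h with h|h|h|h|h|h|h|h|h|h|h|h|h|h <;> subst h <;> decide

theorem Tb_spec {t : WangTile HC (Fin 2)} (h : t ∈ Tb) :
    isA t.west = false ∧ isA t.east = false ∧ enc t ∈ LB := by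
  simp only [Tb, Set.mem_insert_iff, Set.mem_singleton_iff] at h
  rcases h with h|h|h|h|h|h|h|h|h|h|h|h|h|h <;> subst h <;> decide

/-- A biinfinite row of coded tiles. -/
def Row (T : List Tl) (s lo hi : ℤ → ℕ) : Prop :=
  ∀ x, (s x, s (x + 1), lo x, hi x) ∈ T

def comp (X Y : List Tl) : List Tl :=
  X.flatMap fun x => (Y.filter fun y => Nat.beq x.2.2.2 y.2.2.1).map fun y =>
    (x.1 * 10 + y.1, x.2.1 * 10 + y.2.1, x.2.2.1, y.2.2.2)

theorem Row.comp {X Y : List Tl} {s t lo mid hi : ℤ → ℕ} (h₁ : Row X s lo mid)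
    (h₂ : Row Y t mid hi) : Row (comp X Y) (fun x => s x * 10 + t x) lo hi := by
  intro x
  refine List.mem_flatMap.2 ⟨_, h₁ x, List.mem_map.2 ⟨_, List.mem_filter.2 ⟨h₂ x, ?_⟩, rfl⟩⟩
  exact Nat.beq_refl _

/-- Bit mask of a list of numbers. -/
def mask (l : List ℕ) : ℕ := l.foldr (fun a m => 2 ^ a ||| m) 0

theorem testBit_mask {l : List ℕ} {a : ℕ} (h : a ∈ l) : (mask l).testBit a = true := by
  induction l with
  | nil => simp at h
  | cons b l ih =>
    simp only [mask, List.foldr_cons, Nat.testBit_or, Bool.or_eq_true] at ih ⊢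
    rcases List.mem_cons.1 h with h | h
    · subst h; left; exact Nat.testBit_two_pow_self
    · right; exact ih h

def trimAux (T : List Tl) (mw me : ℕ) : List Tl :=
  T.filter fun t => me.testBit t.1 && mw.testBit t.2.1

def trim (T : List Tl) : List Tl :=
  trimAux T (mask (T.map fun t => t.1)) (mask (T.map fun t => t.2.1))

theorem Row.trim {T : List Tl} {s lo hi : ℤ → ℕ} (h : Row T s lo hi) : Row (trim T) s lo hi := by
  intro x
  refine List.mem_filter.2 ⟨h x, ?_⟩
  rw [Bool.and_eq_true]
  constructor
  · apply testBit_mask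
    refine List.mem_map.2 ⟨_, h (x - 1), ?_⟩
    simp
  · exact testBit_mask (List.mem_map.2 ⟨_, h (x + 1), rfl⟩)

def trimN : ℕ → List Tl → List Tl
  | 0, T => T
  | n + 1, T => trimN n (TDRows.trim T)

theorem Row.trimN {s lo hi : ℤ → ℕ} (n : ℕ) {T : List Tl} (h : Row T s lo hi) :
    Row (trimN n T) s lo hi := by
  induction n generalizing T with
  | zero => exact h
  | succ n ih => exact ih h.trim

/-- Overlap of two triple rows sharing one row. -/
def join (X Y : List Tl) : List Tl :=
  X.flatMap fun x =>
    (Y.filter fun y => Nat.beq (x.1 % 10) (y.1 / 100) && Nat.beq (x.2.1 % 10) (y.2.1 / 100)).map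
      fun y => (x.1 * 100 + y.1 % 100, x.2.1 * 100 + y.2.1 % 100, x.2.2.1, y.2.2.2)

theorem Row.join {X Y : List Tl} {s t lo mid lo' hi : ℤ → ℕ} (h₁ : Row X s lo mid)
    (h₂ : Row Y t lo' hi) (h : ∀ x, s x % 10 = t x / 100) :
    Row (join X Y) (fun x => s x * 100 + t x % 100) lo hi := by
  intro x
  refine List.mem_flatMap.2 ⟨_, h₁ x, List.mem_map.2 ⟨_, List.mem_filter.2 ⟨h₂ x, ?_⟩, rfl⟩⟩
  simp [h]

set_option maxRecDepth 100000 in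
theorem aaa_empty : trimN 10 (comp (trimN 5 (comp LA LA)) LA) = [] := by decide +kernel

/-- The trimmed triple rows for the word `bab`. -/
def LBAB : List Tl :=
  [(749, 953, 1, 1), (714, 925, 1, 1), (337, 49, 1, 1), (953, 210, 1, 1), (925, 237, 1, 1),
   (925, 337, 1, 1), (825, 689, 0, 0), (825, 687, 0, 1), (821, 682, 0, 1), (469, 502, 0, 1),
   (449, 553, 0, 1), (425, 537, 0, 1), (421, 532, 0, 1), (714, 825, 0, 1), (710, 821, 0, 1),
   (214, 425, 0, 1), (219, 421, 0, 0), (210, 421, 0, 1), (217, 469, 0, 1), (237, 449, 0, 1),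
   (998, 106, 0, 0), (994, 105, 0, 1), (991, 102, 0, 1), (974, 125, 0, 1), (49, 153, 0, 1),
   (532, 974, 0, 1), (502, 714, 0, 1), (553, 710, 0, 1), (537, 749, 0, 1), (102, 214, 0, 1),
   (105, 219, 0, 0), (105, 217, 0, 1), (106, 219, 0, 0), (153, 210, 0, 1), (125, 237, 0, 1),
   (687, 998, 0, 1), (682, 994, 0, 1), (689, 991, 0, 0)]

set_option maxRecDepth 100000 in
theorem bab_trim : trimN 13 (comp (comp LB LA) LB) = LBAB := by decide +kernel

set_option maxRecDepth 100000 in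
theorem babab_empty : trimN 15 (join LBAB LBAB) = [] := by decide +kernel

theorem Row.not_nil {s lo hi : ℤ → ℕ} (h : Row [] s lo hi) : False := by
  simpa using h 0

theorem not_aaa {s₁ s₂ s₃ l₀ l₁ l₂ l₃ : ℤ → ℕ} (h₁ : Row LA s₁ l₀ l₁) (h₂ : Row LA s₂ l₁ l₂)
    (h₃ : Row LA s₃ l₂ l₃) : False := by
  have h := (((h₁.comp h₂).trimN 5).comp h₃).trimN 10
  rw [aaa_empty] at h
  exact h.not_nil

theorem LB_lt : ∀ t ∈ LB, t.1 < 10 := by decide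
theorem LA_lt : ∀ t ∈ LA, t.1 < 10 := by decide

theorem not_babab {s₁ s₂ s₃ s₄ s₅ l₀ l₁ l₂ l₃ l₄ l₅ : ℤ → ℕ} (h₁ : Row LB s₁ l₀ l₁)
    (h₂ : Row LA s₂ l₁ l₂) (h₃ : Row LB s₃ l₂ l₃) (h₄ : Row LA s₄ l₃ l₄)
    (h₅ : Row LB s₅ l₄ l₅) : False := by
  have h := ((h₁.comp h₂).comp h₃).trimN 13
  have h' := ((h₃.comp h₄).comp h₅).trimN 13
  rw [bab_trim] at h h'
  have k := (h.join h' (fun x => by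
    have a := LB_lt _ (h₃ x)
    have b := LA_lt _ (h₄ x)
    have c := LB_lt _ (h₅ x)
    dsimp only at a b c ⊢
    omega)).trimN 15
  rw [babab_empty] at k
  exact k.not_nil

/-- A word with no `aaa` and no `babab` (`a = 0`, `b = 1`) is a concatenation of blocks. -/
def Block (v : ℤ → Fin 2) (y z : ℤ) : Prop :=
  (z = y + 1 ∧ v y = 1) ∨ (z = y + 2 ∧ v y = 0 ∧ v (y + 1) = 0) ∨
  (z = y + 3 ∧ v y = 1 ∧ v (y + 1) = 0 ∧ v (y + 2) = 1)

def Cut (v : ℤ → Fin 2) (y : ℤ) : Prop :=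
  (v y = 0 ∧ v (y + 1) = 0) ∨ (v y = 1 ∧ ¬ (v (y - 1) = 0 ∧ v (y - 2) = 1))

theorem fin2 (a : Fin 2) : a = 0 ∨ a = 1 := by omega

set_option synthInstance.maxSize 4000 in
set_option synthInstance.maxHeartbeats 400000 in
set_option maxRecDepth 10000 in
theorem next_cut (v : ℤ → Fin 2) (h3 : ∀ y, ¬ (v y = 0 ∧ v (y + 1) = 0 ∧ v (y + 2) = 0))
    (h5 : ∀ y, ¬ (v y = 1 ∧ v (y + 1) = 0 ∧ v (y + 2) = 1 ∧ v (y + 3) = 0 ∧ v (y + 4) = 1))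
    (y : ℤ) (hy : Cut v y) : ∃ z, Cut v z ∧ Block v y z := by
  have e1 := h3 (y + 1)
  have e2 := h3 y
  have e3 := h5 y
  have e4 := h5 (y - 2)
  have e5 := h3 (y + 2)
  simp only [show y + 1 + 1 = y + 2 by ring, show y + 1 + 2 = y + 3 by ring,
    show y + 2 + 1 = y + 3 by ring, show y + 2 + 2 = y + 4 by ring,
    show y - 2 + 1 = y - 1 by ring, show y - 2 + 2 = y by ring, show y - 2 + 3 = y + 1 by ring,
    show y - 2 + 4 = y + 2 by ring] at e1 e2 e3 e4 e5
  have c1 : Cut v (y + 1) ↔ (v (y + 1) = 0 ∧ v (y + 2) = 0) ∨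
      (v (y + 1) = 1 ∧ ¬ (v y = 0 ∧ v (y - 1) = 1)) := by
    simp only [Cut, show y + 1 + 1 = y + 2 by ring, show y + 1 - 1 = y by ring,
      show y + 1 - 2 = y - 1 by ring]
  have c2 : Cut v (y + 2) ↔ (v (y + 2) = 0 ∧ v (y + 3) = 0) ∨
      (v (y + 2) = 1 ∧ ¬ (v (y + 1) = 0 ∧ v y = 1)) := by
    simp only [Cut, show y + 2 + 1 = y + 3 by ring, show y + 2 - 1 = y + 1 by ring,
      show y + 2 - 2 = y by ring]
  have c3 : Cut v (y + 3) ↔ (v (y + 3) = 0 ∧ v (y + 4) = 0) ∨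
      (v (y + 3) = 1 ∧ ¬ (v (y + 2) = 0 ∧ v (y + 1) = 1)) := by
    simp only [Cut, show y + 3 + 1 = y + 4 by ring, show y + 3 - 1 = y + 2 by ring,
      show y + 3 - 2 = y + 1 by ring]
  unfold Cut at hy
  have key : (Cut v (y + 1) ∧ v y = 1) ∨ (Cut v (y + 2) ∧ v y = 0 ∧ v (y + 1) = 0) ∨
      (Cut v (y + 3) ∧ v y = 1 ∧ v (y + 1) = 0 ∧ v (y + 2) = 1) := by
    rw [c1, c2, c3]
    generalize v (y - 2) = a0 at *
    generalize v (y - 1) = a1 at *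
    generalize v y = a2 at *
    generalize v (y + 1) = a3 at *
    generalize v (y + 2) = a4 at *
    generalize v (y + 3) = a5 at *
    generalize v (y + 4) = a6 at *
    clear c1 c2 c3 h3 h5
    revert a0 a1 a2 a3 a4 a5 a6
    decide
  rcases key with ⟨h, k⟩ | ⟨h, k⟩ | ⟨h, k⟩
  · exact ⟨_, h, Or.inl ⟨rfl, k⟩⟩
  · exact ⟨_, h, Or.inr (Or.inl ⟨rfl, k⟩)⟩
  · exact ⟨_, h, Or.inr (Or.inr ⟨rfl, k⟩)⟩

set_option synthInstance.maxSize 4000 in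
set_option synthInstance.maxHeartbeats 400000 in
set_option maxRecDepth 10000 in
theorem prev_cut (v : ℤ → Fin 2) (h3 : ∀ y, ¬ (v y = 0 ∧ v (y + 1) = 0 ∧ v (y + 2) = 0))
    (h5 : ∀ y, ¬ (v y = 1 ∧ v (y + 1) = 0 ∧ v (y + 2) = 1 ∧ v (y + 3) = 0 ∧ v (y + 4) = 1))
    (z : ℤ) (hz : Cut v z) : ∃ y, Cut v y ∧ Block v y z := by
  have e1 := h3 (z - 1)
  have e2 := h3 (z - 2)
  have e3 := h3 (z - 3)
  have e4 := h5 (z - 5)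
  have e5 := h5 (z - 4)
  simp only [show z - 1 + 1 = z by ring, show z - 1 + 2 = z + 1 by ring,
    show z - 2 + 1 = z - 1 by ring, show z - 2 + 2 = z by ring,
    show z - 3 + 1 = z - 2 by ring, show z - 3 + 2 = z - 1 by ring,
    show z - 5 + 1 = z - 4 by ring, show z - 5 + 2 = z - 3 by ring,
    show z - 5 + 3 = z - 2 by ring, show z - 5 + 4 = z - 1 by ring,
    show z - 4 + 1 = z - 3 by ring, show z - 4 + 2 = z - 2 by ring,
    show z - 4 + 3 = z - 1 by ring, show z - 4 + 4 = z by ring] at e1 e2 e3 e4 e5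
  have c1 : Cut v (z - 1) ↔ (v (z - 1) = 0 ∧ v z = 0) ∨
      (v (z - 1) = 1 ∧ ¬ (v (z - 2) = 0 ∧ v (z - 3) = 1)) := by
    simp only [Cut, show z - 1 + 1 = z by ring, show z - 1 - 1 = z - 2 by ring,
      show z - 1 - 2 = z - 3 by ring]
  have c2 : Cut v (z - 2) ↔ (v (z - 2) = 0 ∧ v (z - 1) = 0) ∨
      (v (z - 2) = 1 ∧ ¬ (v (z - 3) = 0 ∧ v (z - 4) = 1)) := by
    simp only [Cut, show z - 2 + 1 = z - 1 by ring, show z - 2 - 1 = z - 3 by ring,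
      show z - 2 - 2 = z - 4 by ring]
  have c3 : Cut v (z - 3) ↔ (v (z - 3) = 0 ∧ v (z - 2) = 0) ∨
      (v (z - 3) = 1 ∧ ¬ (v (z - 4) = 0 ∧ v (z - 5) = 1)) := by
    simp only [Cut, show z - 3 + 1 = z - 2 by ring, show z - 3 - 1 = z - 4 by ring,
      show z - 3 - 2 = z - 5 by ring]
  unfold Cut at hz
  have key : (Cut v (z - 1) ∧ v (z - 1) = 1) ∨
      (Cut v (z - 2) ∧ v (z - 2) = 0 ∧ v (z - 1) = 0) ∨
      (Cut v (z - 3) ∧ v (z - 3) = 1 ∧ v (z - 2) = 0 ∧ v (z - 1) = 1) := by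
    rw [c1, c2, c3]
    generalize v (z - 5) = a0 at *
    generalize v (z - 4) = a1 at *
    generalize v (z - 3) = a2 at *
    generalize v (z - 2) = a3 at *
    generalize v (z - 1) = a4 at *
    generalize v z = a5 at *
    generalize v (z + 1) = a6 at *
    clear c1 c2 c3 h3 h5
    revert a0 a1 a2 a3 a4 a5 a6
    decide
  rcases key with ⟨h, k⟩ | ⟨h, k⟩ | ⟨h, k⟩
  · exact ⟨_, h, Or.inl ⟨by ring, k⟩⟩
  · refine ⟨_, h, Or.inr (Or.inl ⟨by ring, k.1, ?_⟩)⟩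
    rw [show z - 2 + 1 = z - 1 by ring]; exact k.2
  · refine ⟨_, h, Or.inr (Or.inr ⟨by ring, k.1, ?_⟩)⟩
    rw [show z - 3 + 1 = z - 2 by ring, show z - 3 + 2 = z - 1 by ring]; exact k.2

set_option synthInstance.maxSize 4000 in
set_option synthInstance.maxHeartbeats 400000 in
set_option maxRecDepth 10000 in
theorem exists_cut (v : ℤ → Fin 2)
    (h5 : ∀ y, ¬ (v y = 1 ∧ v (y + 1) = 0 ∧ v (y + 2) = 1 ∧ v (y + 3) = 0 ∧ v (y + 4) = 1)) :
    ∃ y, Cut v y := by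
  by_contra h
  push Not at h
  have h0 := h 0
  have h1 := h 1
  have h2 := h 2
  have h3 := h 3
  have h4 := h 4
  have k0 := h5 0
  have k1 := h5 1
  simp only [Cut] at h0 h1 h2 h3 h4
  norm_num at h0 h1 h2 h3 h4 k0 k1
  clear h h5
  generalize v (-2) = a0 at *
  generalize v (-1) = a1 at *
  generalize v 0 = a2 at *
  generalize v 1 = a3 at *
  generalize v 2 = a4 at *
  generalize v 3 = a5 at *
  generalize v 4 = a6 at *
  generalize v 5 = a7 at *
  revert a0 a1 a2 a3 a4 a5 a6 a7
  decide

theorem blocks (v : ℤ → Fin 2) (h3 : ∀ y, ¬ (v y = 0 ∧ v (y + 1) = 0 ∧ v (y + 2) = 0))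
    (h5 : ∀ y, ¬ (v y = 1 ∧ v (y + 1) = 0 ∧ v (y + 2) = 1 ∧ v (y + 3) = 0 ∧ v (y + 4) = 1)) :
    ∃ p : ℤ → ℤ, ∀ k, Block v (p k) (p (k + 1)) := by
  obtain ⟨c, hc⟩ := exists_cut v h5
  choose N hN using fun y : {y // Cut v y} => next_cut v h3 h5 y.1 y.2
  choose Q hQ using fun y : {y // Cut v y} => prev_cut v h3 h5 y.1 y.2
  let N' : {y // Cut v y} → {y // Cut v y} := fun y => ⟨N y, (hN y).1⟩
  let Q' : {y // Cut v y} → {y // Cut v y} := fun y => ⟨Q y, (hQ y).1⟩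
  let c' : {y // Cut v y} := ⟨c, hc⟩
  let p : ℤ → ℤ := fun k => match k with
    | Int.ofNat n => (N'^[n] c').1
    | Int.negSucc n => (Q'^[n + 1] c').1
  refine ⟨p, fun k => ?_⟩
  match k with
  | Int.ofNat n =>
    have : Int.ofNat n + 1 = Int.ofNat (n + 1) := rfl
    rw [this]
    change Block v (N'^[n] c').1 (N'^[n + 1] c').1
    rw [Function.iterate_succ_apply']
    exact (hN _).2
  | Int.negSucc 0 =>
    change Block v (Q' c').1 c'.1
    exact (hQ _).2
  | Int.negSucc (n + 1) =>
    have : Int.negSucc (n + 1) + 1 = Int.negSucc n := rfl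
    rw [this]
    change Block v (Q'^[n + 1 + 1] c').1 (Q'^[n + 1] c').1
    rw [Function.iterate_succ_apply' _ (n + 1)]
    exact (hQ _).2

theorem row_pure (f : ℤ × ℤ → WangTile HC (Fin 2)) (hf : Tiling TD f) (y : ℤ) :
    (∀ x : ℤ, f (x, y) ∈ Ta) ∨ (∀ x : ℤ, f (x, y) ∈ Tb) := by
  obtain ⟨hT, hE, -⟩ := hf
  have mem : ∀ x, f (x, y) ∈ Ta ∨ f (x, y) ∈ Tb := fun x => hT (x, y) trivial
  have iff_a : ∀ x, f (x, y) ∈ Ta ↔ isA (f (x, y)).west = true := by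
    intro x
    refine ⟨fun h => (Ta_spec h).1, fun h => (mem x).resolve_right fun hb => ?_⟩
    simp [(Tb_spec hb).1] at h
  have same : ∀ x, isA (f (x, y)).west = isA (f (x + 1, y)).west := by
    intro x
    rw [← hE x y trivial trivial]
    rcases mem x with h | h
    · rw [(Ta_spec h).1, (Ta_spec h).2.1]
    · rw [(Tb_spec h).1, (Tb_spec h).2.1]
  have const : ∀ x : ℤ, isA (f (x, y)).west = isA (f (0, y)).west := by
    intro x
    induction x using Int.induction_on with
    | zero => rfl
    | succ n ih => rw [← same, ih]
    | pred n ih => rw [same, sub_add_cancel, ih]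
  rcases mem 0 with h | h
  · left
    intro x
    rw [iff_a, const, (Ta_spec h).1]
  · right
    intro x
    refine (mem x).resolve_left fun ha => ?_
    rw [iff_a, const, (Tb_spec h).1] at ha
    exact Bool.false_ne_true ha

theorem main (f : ℤ × ℤ → WangTile HC (Fin 2)) (hf : Tiling TD f) (v : ℤ → Fin 2)
    (hv : ∀ y : ℤ, v y = 0 ↔ ∃ x : ℤ, f (x, y) ∈ Ta) :
    ∃ p : ℤ → ℤ, ∀ k, Block v (p k) (p (k + 1)) := by
  have pure := row_pure f hf
  obtain ⟨-, hE, hN⟩ := hf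
  let s : ℤ → ℤ → ℕ := fun y x => code (f (x, y)).west
  let l : ℤ → ℤ → ℕ := fun y x => (f (x, y)).south.val
  have enc_eq : ∀ x y, enc (f (x, y)) = (s y x, s y (x + 1), l y x, l (y + 1) x) := by
    intro x y
    simp only [enc, s, l, hE x y trivial trivial, hN x y trivial trivial]
  have rowA : ∀ y, v y = 0 → Row LA (s y) (l y) (l (y + 1)) := by
    intro y h x
    rw [← enc_eq]
    obtain ⟨x₀, h₀⟩ := (hv y).1 h
    rcases pure y with hp | hp
    · exact (Ta_spec (hp x)).2.2
    · have := (Ta_spec h₀).1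
      simp [(Tb_spec (hp x₀)).1] at this
  have rowB : ∀ y, v y = 1 → Row LB (s y) (l y) (l (y + 1)) := by
    intro y h x
    rw [← enc_eq]
    rcases pure y with hp | hp
    · have := (hv y).2 ⟨0, hp 0⟩
      rw [h] at this
      exact absurd this (by decide)
    · exact (Tb_spec (hp x)).2.2
  apply blocks
  · rintro y ⟨h1, h2, h3⟩
    have r2 := rowA _ h2
    rw [show y + 1 + 1 = y + 2 by ring] at r2
    exact not_aaa (rowA _ h1) r2 (rowA _ h3)
  · rintro y ⟨h1, h2, h3, h4, h5⟩
    have r2 := rowA _ h2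
    have r3 := rowB _ h3
    have r4 := rowA _ h4
    rw [show y + 1 + 1 = y + 2 by ring] at r2
    rw [show y + 2 + 1 = y + 3 by ring] at r3
    rw [show y + 3 + 1 = y + 4 by ring] at r4
    exact not_babab (rowB _ h1) r2 r3 r4 (rowB _ h5)

end TDRows

/-- in any tiling of the plane by `𝒯_D = 𝒯_a ∪ 𝒯_b`, each row uses tiles
of only one of `𝒯_a`, `𝒯_b`; and the row labelling `v : ℤ → {a,b}` (encoded by
`Fin 2` with `0 = a`, `1 = b`; `v y = 0` iff row `y` uses tiles of `𝒯_a`) is a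
biinfinite concatenation of the blocks `b`, `aa` and `bab`: there is a strictly
increasing sequence `(p k)` of integers tending to `±∞` such that each word
`v (p k) ⋯ v (p (k+1) − 1)` is one of `b`, `aa`, `bab`. -/
theorem TD_rows_structure (f : ℤ × ℤ → WangTile HC (Fin 2)) (hf : Tiling TD f) :
    (∀ y : ℤ, (∀ x : ℤ, f (x, y) ∈ Ta) ∨ (∀ x : ℤ, f (x, y) ∈ Tb)) ∧
    ∀ v : ℤ → Fin 2, (∀ y : ℤ, v y = 0 ↔ ∃ x : ℤ, f (x, y) ∈ Ta) →
      ∃ p : ℤ → ℤ, StrictMono p ∧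
        Filter.Tendsto p Filter.atTop Filter.atTop ∧
        Filter.Tendsto p Filter.atBot Filter.atBot ∧
        ∀ k : ℤ,
          (p (k + 1) = p k + 1 ∧ v (p k) = 1) ∨
          (p (k + 1) = p k + 2 ∧ v (p k) = 0 ∧ v (p k + 1) = 0) ∨
          (p (k + 1) = p k + 3 ∧ v (p k) = 1 ∧ v (p k + 1) = 0 ∧ v (p k + 2) = 1) := by
  refine ⟨TDRows.row_pure f hf, fun v hv => ?_⟩
  obtain ⟨p, hp⟩ := TDRows.main f hf v hv
  have step : ∀ k, p k < p (k + 1) := by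
    intro k
    rcases hp k with h | h | h <;> omega
  have mono : StrictMono p := strictMono_int_of_lt_succ step
  have up : ∀ n : ℕ, p 0 + n ≤ p n := by
    intro n
    induction n with
    | zero => simp
    | succ n ih => have := step n; push_cast; omega
  have down : ∀ n : ℕ, p (-n) ≤ p 0 - n := by
    intro n
    induction n with
    | zero => simp
    | succ n ih =>
      have := step (-(n : ℤ) - 1)
      rw [sub_add_cancel] at this
      push_cast
      rw [show -((n : ℤ) + 1) = -(n : ℤ) - 1 by ring]
      omega
  refine ⟨p, mono, ?_, ?_, fun k => hp k⟩
  · refine Filter.tendsto_atTop_atTop_of_monotone mono.monotone fun b => ?_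
    exact ⟨((b - p 0).toNat : ℕ), by have := up (b - p 0).toNat; omega⟩
  · refine Filter.tendsto_atBot_atBot_of_monotone mono.monotone fun b => ?_
    exact ⟨-((p 0 - b).toNat : ℕ), by have := down (p 0 - b).toNat; omega⟩
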